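/- arXiv:1708.05140 — 8 statements merged into one kernel-verified Lean document; each statement's English description precedes it below -/
import Mathlib

section
/- Assume the voltage upper bounds are uniform, V̄_1=⋯=V̄_n>0, and p̲_i≤0 for all i∈N. Let (p,v,W) be feasible for RL1 and suppose the rank constraint fails on some edge s∼t, i.e., W_{st}W_{ts} < v_s v_t. If p_s = p̲_s, then v_s < V̄_s²; likewise, if p_t = p̲_t, then v_t < V̄_t². In particular, at such a point the power-injection lower bound and the nodal-voltage upper bound of bus s (respectively t) cannot bind simultaneously. -/
open Finset

/-- Power injection at bus `i` determined by `(v, W)` and conductances `y`. -/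
def inj {n : ℕ} (G : SimpleGraph (Fin n)) [DecidableRel G.Adj]
    (y : Fin n → Fin n → ℝ) (v : Fin n → ℝ) (W : Fin n → Fin n → ℝ) (i : Fin n) : ℝ :=
  ∑ j ∈ univ.filter (fun j => G.Adj i j), (v i - W i j) * y i j

/-- Feasibility for the SOCP relaxation RL1. -/
def FeasRL1 {n : ℕ} (G : SimpleGraph (Fin n)) [DecidableRel G.Adj]
    (y : Fin n → Fin n → ℝ) (pLo pHi VLo VHi : Fin n → ℝ)
    (p v : Fin n → ℝ) (W : Fin n → Fin n → ℝ) : Prop :=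
  (∀ i, p i = inj G y v W i) ∧
  (∀ i, pLo i ≤ p i ∧ p i ≤ pHi i) ∧
  (∀ i, VLo i ^ 2 ≤ v i ∧ v i ≤ VHi i ^ 2) ∧
  (∀ i j, G.Adj i j → 0 ≤ W i j) ∧
  (∀ i j, G.Adj i j → W i j = W j i) ∧
  (∀ i j, G.Adj i j → W i j * W j i ≤ v i * v j)

/-- At a bus whose voltage is maximal, a strict rank inequality on an incident edge makes the
injection positive. -/
theorem inj_pos_of_rank_lt {n : ℕ} (G : SimpleGraph (Fin n)) [DecidableRel G.Adj]
    {y : Fin n → Fin n → ℝ} {v : Fin n → ℝ} {W : Fin n → Fin n → ℝ} {s t : Fin n}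
    (hy : ∀ j, G.Adj s j → 0 < y s j) (hv : 0 ≤ v s) (hmax : ∀ j, v j ≤ v s)
    (hsym : ∀ j, G.Adj s j → W s j = W j s)
    (hW : ∀ j, G.Adj s j → W s j * W j s ≤ v s * v j)
    (hst : G.Adj s t) (hlt : W s t * W t s < v s * v t) :
    0 < inj G y v W s := by
  have hle (j : Fin n) : v s * v j ≤ v s * v s := mul_le_mul_of_nonneg_left (hmax j) hv
  refine Finset.sum_pos' (fun j hj => ?_) ⟨t, by simpa using hst, ?_⟩
  · have hadj : G.Adj s j := by simpa using hj
    have h := (hW j hadj).trans (hle j)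
    rw [← hsym j hadj] at h
    exact mul_nonneg (sub_nonneg.2 (abs_le_of_sq_le_sq' (by nlinarith) hv).2) (hy j hadj).le
  · have h := hlt.trans_le (hle t)
    rw [← hsym t hst] at h
    exact mul_pos (sub_pos.2 (abs_lt_of_sq_lt_sq' (by nlinarith) hv).2) (hy t hst)

/-- Lemma 2 of the paper. Assume uniform positive voltage upper
bounds and `pLo i ≤ 0`. If `(p, v, W)` is feasible for RL1 and the rank constraint
fails on an edge `s ∼ t`, then binding of the power-injection lower bound at `s`
(resp. `t`) forces the voltage upper bound at `s` (resp. `t`) to be slack. -/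
theorem lower_bound_voltage_slack {n : ℕ} (G : SimpleGraph (Fin n)) [DecidableRel G.Adj]
    (y : Fin n → Fin n → ℝ) (pLo pHi VLo VHi : Fin n → ℝ)
    (hVLo : ∀ i, 0 < VLo i) (hVbd : ∀ i, VLo i ≤ VHi i)
    (hVHiuni : ∀ i j, VHi i = VHi j) (hVHipos : ∀ i, 0 < VHi i)
    (hpLo : ∀ i, pLo i ≤ 0) (hpHi : ∀ i, 0 ≤ pHi i)
    (hy : ∀ i j, G.Adj i j → 0 < y i j) (hysym : ∀ i j, y i j = y j i)
    (p v : Fin n → ℝ) (W : Fin n → Fin n → ℝ)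
    (hfeas : FeasRL1 G y pLo pHi VLo VHi p v W)
    (s t : Fin n) (hst : G.Adj s t)
    (hviol : W s t * W t s < v s * v t) :
    (p s = pLo s → v s < VHi s ^ 2) ∧ (p t = pLo t → v t < VHi t ^ 2) := by
  obtain ⟨hp, -, hv, -, hsym, hW⟩ := hfeas
  have key (a b : Fin n) (hab : G.Adj a b) (hlt : W a b * W b a < v a * v b)
      (hpa : p a = pLo a) : v a < VHi a ^ 2 := by
    refine (hv a).2.lt_of_ne fun heq => ?_
    have hpos := inj_pos_of_rank_lt G (hy a) (heq ▸ sq_nonneg (VHi a))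
      (fun j => heq ▸ hVHiuni j a ▸ (hv j).2) (hsym a) (hW a) hab hlt
    linarith [hp a, hpLo a]
  exact ⟨key s t hst hviol, key t s hst.symm (by linarith)⟩
end

section
/- Assume the voltage upper bounds are uniform, V̄_1=⋯=V̄_n>0, p̲_i≤0 for all i∈N, and each f_i is strictly increasing. Let (p,v,W) be feasible for RL1, suppose the rank constraint fails on some edge s∼t (W_{st}W_{ts} < v_s v_t), and suppose p_s > p̲_s and p_t > p̲_t. Then there exists another feasible point (p',v,W') of RL1 (with the same v) such that h(p') < h(p). Explicitly, one may take any ε with 0 < ε < min{(p_s−p̲_s)/y_{st}, (p_t−p̲_t)/y_{st}, √(v_s v_t)−W_{st}}, set W'_{st}=W'_{ts}=W_{st}+ε, W'_{ij}=W_{ij} otherwise, and p'_i=Σ_{j∼i}(v_i−W'_{ij})y_{ij}; then p'_i=p_i for i∉{s,t} and p'_i=p_i−y_{st}ε for i∈{s,t}. -/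
open Finset

/-- The modified `W` obtained by adding `ε` on the (ordered pairs of the) edge `s ∼ t`. -/
def Wmod {n : ℕ} (s t : Fin n) (ε : ℝ) (W : Fin n → Fin n → ℝ) : Fin n → Fin n → ℝ :=
  fun i j => if (i = s ∧ j = t) ∨ (i = t ∧ j = s) then W i j + ε else W i j

theorem Wmod_swap {n : ℕ} (s t : Fin n) (ε : ℝ) (W : Fin n → Fin n → ℝ) :
    Wmod t s ε W = Wmod s t ε W := by
  funext i j
  simp only [Wmod, or_comm]

theorem inj_Wmod_of_ne {n : ℕ} (G : SimpleGraph (Fin n)) [DecidableRel G.Adj]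
    (y : Fin n → Fin n → ℝ) (v : Fin n → ℝ) (W : Fin n → Fin n → ℝ) (ε : ℝ) {s t i : Fin n}
    (hs : i ≠ s) (ht : i ≠ t) : inj G y v (Wmod s t ε W) i = inj G y v W i := by
  simp [inj, Wmod, hs, ht]

theorem inj_Wmod_left {n : ℕ} (G : SimpleGraph (Fin n)) [DecidableRel G.Adj]
    (y : Fin n → Fin n → ℝ) (v : Fin n → ℝ) (W : Fin n → Fin n → ℝ) (ε : ℝ) {s t : Fin n}
    (hst : G.Adj s t) : inj G y v (Wmod s t ε W) s = inj G y v W s - y s t * ε := by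
  have ht : t ∈ univ.filter (fun j => G.Adj s j) := by simpa using hst
  simp only [inj]
  rw [← Finset.add_sum_erase _ _ ht, ← Finset.add_sum_erase _ _ ht]
  have hrest : ∀ j ∈ (univ.filter (fun j => G.Adj s j)).erase t,
      (v s - Wmod s t ε W s j) * y s j = (v s - W s j) * y s j := by
    intro j hj
    simp [Wmod, Finset.ne_of_mem_erase hj, hst.ne]
  rw [Finset.sum_congr rfl hrest]
  simp only [Wmod, true_and, true_or, if_true]
  ring

theorem inj_Wmod_right {n : ℕ} (G : SimpleGraph (Fin n)) [DecidableRel G.Adj]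
    (y : Fin n → Fin n → ℝ) (v : Fin n → ℝ) (W : Fin n → Fin n → ℝ) (ε : ℝ) {s t : Fin n}
    (hst : G.Adj s t) : inj G y v (Wmod s t ε W) t = inj G y v W t - y t s * ε := by
  rw [← Wmod_swap, inj_Wmod_left G y v W ε hst.symm]

theorem Wmod_nonneg {n : ℕ} {s t : Fin n} {ε : ℝ} {W : Fin n → Fin n → ℝ} (hε : 0 ≤ ε)
    {i j : Fin n} (h : 0 ≤ W i j) : 0 ≤ Wmod s t ε W i j := by
  unfold Wmod
  split_ifs <;> linarith

theorem Wmod_symm {n : ℕ} (s t : Fin n) (ε : ℝ) {W : Fin n → Fin n → ℝ}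
    {i j : Fin n} (h : W i j = W j i) : Wmod s t ε W i j = Wmod s t ε W j i := by
  have hiff : ((i = s ∧ j = t) ∨ (i = t ∧ j = s)) ↔ ((j = s ∧ i = t) ∨ (j = t ∧ i = s)) := by
    tauto
  simp only [Wmod, h, hiff]

theorem Wmod_mul_le {n : ℕ} {s t : Fin n} {ε : ℝ} {W : Fin n → Fin n → ℝ} {v : Fin n → ℝ}
    (hmod : (W s t + ε) * (W t s + ε) ≤ v s * v t) {i j : Fin n}
    (h : W i j * W j i ≤ v i * v j) :
    Wmod s t ε W i j * Wmod s t ε W j i ≤ v i * v j := by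
  by_cases hij : (i = s ∧ j = t) ∨ (i = t ∧ j = s)
  · rcases hij with ⟨rfl, rfl⟩ | ⟨rfl, rfl⟩
    · simpa [Wmod] using hmod
    · simpa [Wmod, mul_comm] using hmod
  · have hji : ¬((j = s ∧ i = t) ∨ (j = t ∧ i = s)) := by tauto
    simpa only [Wmod, if_neg hij, if_neg hji] using h

/-- Lemma 3 of the paper. Assume uniform positive voltage upper
bounds, `pLo i ≤ 0`, and strictly increasing cost functions. Let `(p, v, W)` be
feasible for RL1, let the rank constraint fail on an edge `s ∼ t`, and suppose the
power-injection lower bounds at `s` and `t` are both slack. Then there is a feasible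
point `(p', v, W')` with strictly smaller objective; explicitly, for any
`0 < ε < min {(pₛ−p̲ₛ)/y_{st}, (pₜ−p̲ₜ)/y_{st}, √(vₛvₜ)−W_{st}}`, setting
`W' = Wmod s t ε W` and `p'_i = ∑_{j∼i}(v_i−W'_{ij})y_{ij}` works, and
`p'_i = p_i` for `i ∉ {s,t}` while `p'_i = p_i − y_{st}ε` for `i ∈ {s,t}`. -/
theorem rank_violation_both_slack {n : ℕ} (G : SimpleGraph (Fin n)) [DecidableRel G.Adj]
    (y : Fin n → Fin n → ℝ) (pLo pHi VLo VHi : Fin n → ℝ) (f : Fin n → ℝ → ℝ)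
    (hVLo : ∀ i, 0 < VLo i) (hVbd : ∀ i, VLo i ≤ VHi i)
    (hVHiuni : ∀ i j, VHi i = VHi j) (hVHipos : ∀ i, 0 < VHi i)
    (hpLo : ∀ i, pLo i ≤ 0) (hpHi : ∀ i, 0 ≤ pHi i)
    (hy : ∀ i j, G.Adj i j → 0 < y i j) (hysym : ∀ i j, y i j = y j i)
    (hf : ∀ i, StrictMono (f i))
    (p v : Fin n → ℝ) (W : Fin n → Fin n → ℝ)
    (hfeas : FeasRL1 G y pLo pHi VLo VHi p v W)
    (s t : Fin n) (hst : G.Adj s t)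
    (hviol : W s t * W t s < v s * v t)
    (hps : pLo s < p s) (hpt : pLo t < p t) :
    (∃ p' W', FeasRL1 G y pLo pHi VLo VHi p' v W' ∧
      ∑ i, f i (p' i) < ∑ i, f i (p i)) ∧
    ∀ ε : ℝ, 0 < ε →
      ε < min (min ((p s - pLo s) / y s t) ((p t - pLo t) / y s t))
          (Real.sqrt (v s * v t) - W s t) →
      FeasRL1 G y pLo pHi VLo VHi
        (fun i => inj G y v (Wmod s t ε W) i) v (Wmod s t ε W) ∧
      (∑ i, f i (inj G y v (Wmod s t ε W) i)) < ∑ i, f i (p i) ∧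
      (∀ i, i ≠ s → i ≠ t → inj G y v (Wmod s t ε W) i = p i) ∧
      inj G y v (Wmod s t ε W) s = p s - y s t * ε ∧
      inj G y v (Wmod s t ε W) t = p t - y s t * ε := by
  obtain ⟨hp, hpb, hvb, hW0, hWsymm, hWle⟩ := hfeas
  have hyst : 0 < y s t := hy s t hst
  have hWst : 0 ≤ W s t := hW0 s t hst
  have hWts : W t s = W s t := (hWsymm s t hst).symm
  have hsmod (ε : ℝ) : inj G y v (Wmod s t ε W) s = p s - y s t * ε := by
    rw [inj_Wmod_left G y v W ε hst, hp s]
  have htmod (ε : ℝ) : inj G y v (Wmod s t ε W) t = p t - y s t * ε := by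
    rw [inj_Wmod_right G y v W ε hst, hp t, hysym s t]
  have hother (ε : ℝ) (i : Fin n) (his : i ≠ s) (hit : i ≠ t) :
      inj G y v (Wmod s t ε W) i = p i := by
    rw [inj_Wmod_of_ne G y v W ε his hit, hp i]
  have main : ∀ ε : ℝ, 0 < ε →
      ε < min (min ((p s - pLo s) / y s t) ((p t - pLo t) / y s t))
          (Real.sqrt (v s * v t) - W s t) →
      FeasRL1 G y pLo pHi VLo VHi
        (fun i => inj G y v (Wmod s t ε W) i) v (Wmod s t ε W) ∧
      (∑ i, f i (inj G y v (Wmod s t ε W) i)) < ∑ i, f i (p i) := by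
    intro ε hε hlt
    obtain ⟨⟨hεs, hεt⟩, hεW⟩ : (ε < (p s - pLo s) / y s t ∧ ε < (p t - pLo t) / y s t) ∧
        ε < Real.sqrt (v s * v t) - W s t := by simpa only [lt_min_iff] using hlt
    rw [lt_div_iff₀ hyst] at hεs hεt
    have hyε : 0 < y s t * ε := mul_pos hyst hε
    have hle (i : Fin n) : inj G y v (Wmod s t ε W) i ≤ p i := by
      by_cases his : i = s
      · subst his
        linarith [hsmod ε]
      by_cases hit : i = t
      · subst hit
        linarith [htmod ε]
      exact (hother ε i his hit).le
    have hlo (i : Fin n) : pLo i ≤ inj G y v (Wmod s t ε W) i := by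
      by_cases his : i = s
      · subst his
        linarith [hsmod ε]
      by_cases hit : i = t
      · subst hit
        linarith [htmod ε]
      exact (hpb i).1.trans_eq (hother ε i his hit).symm
    have hmod : (W s t + ε) * (W t s + ε) ≤ v s * v t := by
      rw [hWts, ← sq]
      exact (Real.le_sqrt' (by linarith)).1 (by linarith)
    refine ⟨⟨fun i => rfl, fun i => ⟨hlo i, (hle i).trans (hpb i).2⟩, hvb,
      fun i j h => Wmod_nonneg hε.le (hW0 i j h), fun i j h => Wmod_symm s t ε (hWsymm i j h),
      fun i j h => Wmod_mul_le hmod (hWle i j h)⟩, ?_⟩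
    refine Finset.sum_lt_sum (fun i _ => (hf i).monotone (hle i)) ⟨s, mem_univ s, hf s ?_⟩
    linarith [hsmod ε]
  refine ⟨?_, fun ε hε hlt =>
    ⟨(main ε hε hlt).1, (main ε hε hlt).2, hother ε, hsmod ε, htmod ε⟩⟩
  have hpos : 0 < min (min ((p s - pLo s) / y s t) ((p t - pLo t) / y s t))
      (Real.sqrt (v s * v t) - W s t) := by
    refine lt_min (lt_min (div_pos (sub_pos.2 hps) hyst) (div_pos (sub_pos.2 hpt) hyst))
      (sub_pos.2 ?_)
    rw [Real.lt_sqrt hWst, sq]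
    rwa [hWts] at hviol
  obtain ⟨ε, hε, hlt⟩ := exists_between hpos
  exact ⟨_, _, main ε hε hlt⟩
end

section
/- Assume the voltage upper bounds are uniform, V̄_1=⋯=V̄_n>0, p̲_i≤0 for all i∈N, and each f_i is strictly increasing. Let (p,v,W) be feasible for RL1, suppose the rank constraint fails on some edge s∼t (W_{st}W_{ts} < v_s v_t), and suppose exactly one of the two lower bounds binds: either (p_s=p̲_s and p_t>p̲_t) or (p_s>p̲_s and p_t=p̲_t). Then there exists another feasible point (p',v',W') of RL1 with h(p') < h(p). -/
open Finset

theorem inj_add {n : ℕ} (G : SimpleGraph (Fin n)) [DecidableRel G.Adj]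
    (y : Fin n → Fin n → ℝ) (v v' : Fin n → ℝ) (W W' : Fin n → Fin n → ℝ) (i : Fin n) :
    inj G y (v + v') (W + W') i = inj G y v W i + inj G y v' W' i := by
  simp only [inj, Pi.add_apply, ← Finset.sum_add_distrib]
  exact Finset.sum_congr rfl fun j _ => by ring

/-- Change of the products `W i j` that raises them by `δ` on the edge `{s, t}` only. -/
def edgeBump {n : ℕ} (s t : Fin n) (δ : ℝ) (i j : Fin n) : ℝ :=
  if (i = s ∧ j = t) ∨ (i = t ∧ j = s) then δ else 0

theorem edgeBump_symm {n : ℕ} (s t : Fin n) (δ : ℝ) (i j : Fin n) :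
    edgeBump s t δ i j = edgeBump s t δ j i := by
  simp only [edgeBump]
  exact if_congr (by tauto) rfl rfl

theorem edgeBump_nonneg {n : ℕ} (s t : Fin n) {δ : ℝ} (hδ : 0 ≤ δ) (i j : Fin n) :
    0 ≤ edgeBump s t δ i j := by
  unfold edgeBump
  split_ifs <;> simp [hδ]

theorem inj_bump_source {n : ℕ} (G : SimpleGraph (Fin n)) [DecidableRel G.Adj]
    (y : Fin n → Fin n → ℝ) {s t : Fin n} (hst : G.Adj s t) (ε δ : ℝ) :
    inj G y (Pi.single s ε) (edgeBump s t δ) s =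
      ε * ∑ j ∈ univ.filter (fun j => G.Adj s j), y s j - δ * y s t := by
  have hne : s ≠ t := hst.ne
  simp [inj, edgeBump, hne, sub_mul, Finset.sum_sub_distrib, Finset.mul_sum, hst]

theorem inj_bump_target {n : ℕ} (G : SimpleGraph (Fin n)) [DecidableRel G.Adj]
    (y : Fin n → Fin n → ℝ) {s t : Fin n} (hst : G.Adj s t) (ε δ : ℝ) :
    inj G y (Pi.single s ε) (edgeBump s t δ) t = -(δ * y t s) := by
  have hne : t ≠ s := hst.ne'
  simp [inj, edgeBump, hne, hst.symm]

theorem inj_bump_other {n : ℕ} (G : SimpleGraph (Fin n)) [DecidableRel G.Adj]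
    (y : Fin n → Fin n → ℝ) {s t i : Fin n} (his : i ≠ s) (hit : i ≠ t) (ε δ : ℝ) :
    inj G y (Pi.single s ε) (edgeBump s t δ) i = 0 := by
  simp [inj, edgeBump, his, hit]

/-- At a bus with nonpositive injection that is incident to a rank-violating edge, the voltage
upper bound is not attained. -/
theorem voltage_lt_of_inj_nonpos {n : ℕ} {G : SimpleGraph (Fin n)} [DecidableRel G.Adj]
    {y : Fin n → Fin n → ℝ} {pLo pHi VLo VHi p v : Fin n → ℝ} {W : Fin n → Fin n → ℝ}
    (hVHiuni : ∀ i j, VHi i = VHi j) (hVLo : ∀ i, 0 < VLo i)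
    (hy : ∀ i j, G.Adj i j → 0 < y i j)
    (hfeas : FeasRL1 G y pLo pHi VLo VHi p v W) {s t : Fin n} (hst : G.Adj s t)
    (hviol : W s t * W t s < v s * v t) (hps : p s ≤ 0) :
    v s < VHi s ^ 2 := by
  obtain ⟨hinj, -, hv, hW0, hWs, hWr⟩ := hfeas
  by_contra! hle
  have hvpos : ∀ i, 0 < v i := fun i => (pow_pos (hVLo i) 2).trans_le (hv i).1
  have hvmax : ∀ j, v j ≤ v s := fun j => by
    have := (hv j).2
    rw [hVHiuni j s] at this
    exact this.trans hle
  have hWle : ∀ j, G.Adj s j → W s j ≤ v s := fun j hj => by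
    have h := hWr s j hj
    rw [← hWs s j hj] at h
    nlinarith [hvmax j, hvpos s]
  have hWlt : W s t < v s := by
    rw [← hWs s t hst] at hviol
    nlinarith [hvmax t, hvpos s]
  have hpos : 0 < p s := by
    rw [hinj s, inj]
    refine Finset.sum_pos' (fun j hj => ?_) ⟨t, by simpa using hst, ?_⟩
    · have hj' : G.Adj s j := by simpa using hj
      exact mul_nonneg (sub_nonneg.2 (hWle j hj')) (hy s j hj').le
    · exact mul_pos (sub_pos.2 hWlt) (hy s t hst)
  linarith

/-- Raising `v s` and `W s t` together so that the injection at `s` is kept and the one at `t`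
drops strictly improves the objective. -/
theorem exists_lt_of_slack_at_target {n : ℕ} (G : SimpleGraph (Fin n)) [DecidableRel G.Adj]
    (y : Fin n → Fin n → ℝ) (pLo pHi VLo VHi : Fin n → ℝ) (f : Fin n → ℝ → ℝ)
    (hVLo : ∀ i, 0 < VLo i) (hVHiuni : ∀ i j, VHi i = VHi j)
    (hy : ∀ i j, G.Adj i j → 0 < y i j) (hf : ∀ i, StrictMono (f i))
    (p v : Fin n → ℝ) (W : Fin n → Fin n → ℝ)
    (hfeas : FeasRL1 G y pLo pHi VLo VHi p v W)
    (s t : Fin n) (hst : G.Adj s t)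
    (hviol : W s t * W t s < v s * v t) (hps : p s ≤ 0) (hpt : pLo t < p t) :
    ∃ p' v' W', FeasRL1 G y pLo pHi VLo VHi p' v' W' ∧
      ∑ i, f i (p' i) < ∑ i, f i (p i) := by
  have hvs := voltage_lt_of_inj_nonpos hVHiuni hVLo hy hfeas hst hviol hps
  obtain ⟨hinj, hp, hv, hW0, hWs, hWr⟩ := hfeas
  have hvpos : ∀ i, 0 < v i := fun i => (pow_pos (hVLo i) 2).trans_le (hv i).1
  have hyst := hy s t hst
  have hyts := hy t s hst.symm
  set D := ∑ j ∈ univ.filter (fun j => G.Adj s j), y s j with hD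
  have hyD : y s t ≤ D :=
    Finset.single_le_sum (f := fun j => y s j)
      (fun j hj => (hy s j (by simpa using hj)).le) (by simpa using hst)
  have hDpos : 0 < D := hyst.trans_le hyD
  have hWlt : W s t < √(v s * v t) := by
    rw [← hWs s t hst] at hviol
    exact Real.lt_sqrt_of_sq_lt (by rwa [pow_two])
  obtain ⟨δ, hδ, hδle⟩ : ∃ δ : ℝ, 0 < δ ∧
      δ ≤ min (VHi s ^ 2 - v s) (min ((p t - pLo t) / y t s) (√(v s * v t) - W s t)) :=
    ⟨_, lt_min (sub_pos.2 hvs) (lt_min (div_pos (sub_pos.2 hpt) hyts) (sub_pos.2 hWlt)), le_rfl⟩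
  simp only [le_min_iff, le_div_iff₀ hyts] at hδle
  obtain ⟨hδv, hδp, hδW⟩ := hδle
  set ε := δ * y s t / D with hε
  have hε0 : 0 ≤ ε := by positivity
  have hεδ : ε ≤ δ := by
    rw [hε, div_le_iff₀ hDpos]
    exact mul_le_mul_of_nonneg_left hyD hδ.le
  have hWδ : (W s t + δ) * (W s t + δ) ≤ v s * v t := by
    have h0 := hW0 s t hst
    rw [← Real.mul_self_sqrt (mul_pos (hvpos s) (hvpos t)).le]
    exact mul_self_le_mul_self (by linarith) (by linarith)
  have hsingle : (0 : Fin n → ℝ) ≤ Pi.single s ε := Pi.single_nonneg.2 hε0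
  have hvle : ∀ i, v i ≤ (v + Pi.single s ε : Fin n → ℝ) i := fun i =>
    le_add_of_nonneg_right (hsingle i)
  have hps' : inj G y (v + Pi.single s ε) (W + edgeBump s t δ) s = p s := by
    rw [inj_add, inj_bump_source G y hst, ← hinj, ← hD, hε, div_mul_cancel₀ _ hDpos.ne']
    ring
  have hpt' : inj G y (v + Pi.single s ε) (W + edgeBump s t δ) t = p t - δ * y t s := by
    rw [inj_add, inj_bump_target G y hst, ← hinj]
    ring
  have hpo' : ∀ i, i ≠ t → inj G y (v + Pi.single s ε) (W + edgeBump s t δ) i = p i := by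
    intro i hit
    by_cases his : i = s
    · rw [his, hps']
    · rw [inj_add, inj_bump_other G y his hit, ← hinj, add_zero]
  have hdrop : 0 < δ * y t s := mul_pos hδ hyts
  refine ⟨inj G y (v + Pi.single s ε) (W + edgeBump s t δ), v + Pi.single s ε,
    W + edgeBump s t δ, ⟨fun _ => rfl, fun i => ?_, fun i => ⟨(hv i).1.trans (hvle i), ?_⟩,
      fun i j hij => add_nonneg (hW0 i j hij) (edgeBump_nonneg s t hδ.le i j),
      fun i j hij => ?_, fun i j hij => ?_⟩, ?_⟩
  · by_cases hit : i = t
    · rw [hit, hpt']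
      exact ⟨by linarith, by linarith [(hp t).2]⟩
    · rw [hpo' i hit]
      exact hp i
  · by_cases his : i = s
    · subst his
      rw [Pi.add_apply, Pi.single_eq_same]
      linarith
    · rw [Pi.add_apply, Pi.single_eq_of_ne his, add_zero]
      exact (hv i).2
  · simp only [Pi.add_apply, hWs i j hij, edgeBump_symm s t δ i j]
  · refine le_trans ?_ (mul_le_mul (hvle i) (hvle j) (hvpos j).le ((hvpos i).le.trans (hvle i)))
    simp only [Pi.add_apply, edgeBump_symm s t δ j i, ← hWs i j hij]
    unfold edgeBump
    split_ifs with h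
    · rcases h with ⟨rfl, rfl⟩ | ⟨rfl, rfl⟩
      · exact hWδ
      · rw [hWs i j hij, mul_comm (v i)]
        exact hWδ
    · have h := hWr i j hij
      rw [← hWs i j hij] at h
      simpa using h
  · refine Finset.sum_lt_sum (fun i _ => (hf i).monotone ?_) ⟨t, mem_univ t, hf t ?_⟩
    · by_cases hit : i = t
      · rw [hit, hpt']
        linarith
      · exact (hpo' i hit).le
    · rw [hpt']
      linarith

/-- Lemma 4 of the paper. Assume uniform positive voltage upper
bounds, `pLo i ≤ 0`, and strictly increasing cost functions. If `(p, v, W)` is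
feasible for RL1, the rank constraint fails on an edge `s ∼ t`, and exactly one of
the two power-injection lower bounds at `s`, `t` binds, then there is another
feasible point `(p', v', W')` with strictly smaller objective value. -/
theorem rank_violation_one_binding {n : ℕ} (G : SimpleGraph (Fin n)) [DecidableRel G.Adj]
    (y : Fin n → Fin n → ℝ) (pLo pHi VLo VHi : Fin n → ℝ) (f : Fin n → ℝ → ℝ)
    (hVLo : ∀ i, 0 < VLo i) (hVbd : ∀ i, VLo i ≤ VHi i)
    (hVHiuni : ∀ i j, VHi i = VHi j) (hVHipos : ∀ i, 0 < VHi i)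
    (hpLo : ∀ i, pLo i ≤ 0) (hpHi : ∀ i, 0 ≤ pHi i)
    (hy : ∀ i j, G.Adj i j → 0 < y i j) (hysym : ∀ i j, y i j = y j i)
    (hf : ∀ i, StrictMono (f i))
    (p v : Fin n → ℝ) (W : Fin n → Fin n → ℝ)
    (hfeas : FeasRL1 G y pLo pHi VLo VHi p v W)
    (s t : Fin n) (hst : G.Adj s t)
    (hviol : W s t * W t s < v s * v t)
    (hbind : (p s = pLo s ∧ pLo t < p t) ∨ (pLo s < p s ∧ p t = pLo t)) :
    ∃ p' v' W', FeasRL1 G y pLo pHi VLo VHi p' v' W' ∧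
      ∑ i, f i (p' i) < ∑ i, f i (p i) := by
  rcases hbind with ⟨hs, ht⟩ | ⟨hs, ht⟩
  · exact exists_lt_of_slack_at_target G y pLo pHi VLo VHi f hVLo hVHiuni hy hf p v W hfeas s t hst
      hviol (hs ▸ hpLo s) ht
  · exact exists_lt_of_slack_at_target G y pLo pHi VLo VHi f hVLo hVHiuni hy hf p v W hfeas t s
      hst.symm (by rwa [mul_comm, mul_comm (v t)]) (ht ▸ hpLo t) hs
end

section
/- Assume the voltage upper bounds are uniform, V̄_1=⋯=V̄_n>0, and p̲_i≤0 for all i∈N. Let (p,v,W) be feasible for RL1, suppose the rank constraint fails on some edge s∼t (W_{st}W_{ts} < v_s v_t), and suppose p_s=p̲_s and p_t=p̲_t. Then there exists (p,v',W') feasible for RL1, with the same power injections p, such that the rank constraint fails (W'_{ij}W'_{ji} < v'_i v'_j) on the edge s∼t and on every edge i∼j that shares a vertex with {s,t}. -/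
open Finset

/-- Injections are linear in `(v, W)`. -/
theorem inj_add_smul {n : ℕ} (G : SimpleGraph (Fin n)) [DecidableRel G.Adj]
    (y : Fin n → Fin n → ℝ) (v d : Fin n → ℝ) (W e : Fin n → Fin n → ℝ) (ε : ℝ) (i : Fin n) :
    inj G y (fun i => v i + ε * d i) (fun i j => W i j + ε * e i j) i =
      inj G y v W i + ε * inj G y d e i := by
  unfold inj
  rw [mul_sum, ← sum_add_distrib]
  exact sum_congr rfl fun j _ => by ring

/-- If bus `s` attained the uniform upper bound while an incident edge is slack, its injection
would be positive. -/
theorem lt_upper_of_slack {n : ℕ} (G : SimpleGraph (Fin n)) [DecidableRel G.Adj]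
    (y : Fin n → Fin n → ℝ) (hy : ∀ i j, G.Adj i j → 0 < y i j)
    (v : Fin n → ℝ) (W : Fin n → Fin n → ℝ) (M : ℝ) (hM : ∀ i, v i ≤ M) (hv : ∀ i, 0 < v i)
    (hWsymm : ∀ i j, G.Adj i j → W i j = W j i)
    (hW : ∀ i j, G.Adj i j → W i j * W j i ≤ v i * v j)
    (s t : Fin n) (hst : G.Adj s t) (hviol : W s t * W t s < v s * v t)
    (hp : inj G y v W s ≤ 0) : v s < M := by
  by_contra! h
  have hs : v s = M := le_antisymm (hM s) h
  have hprod (j : Fin n) : v s * v j ≤ v s * v s :=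
    mul_le_mul_of_nonneg_left ((hM j).trans h) (hv s).le
  have hle (j : Fin n) (hj : G.Adj s j) : W s j ≤ v s := by
    have h1 := hW s j hj
    rw [← hWsymm s j hj] at h1
    nlinarith [hprod j, hv s]
  have hlt : W s t < v s := by
    rw [← hWsymm s t hst] at hviol
    nlinarith [hprod t, hv s]
  refine hp.not_gt (sum_pos' (fun j hj => ?_) ⟨t, by simp [hst], ?_⟩)
  · have hj : G.Adj s j := by simpa using hj
    exact mul_nonneg (sub_nonneg.2 (hle j hj)) (hy s j hj).le
  · exact mul_pos (sub_pos.2 hlt) (hy s t hst)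

/-- Any nonnegative perturbation `e` of `W` is balanced, with zero net injection, by a
nonnegative perturbation of `v` that is positive or zero according to the row of `e`. -/
theorem exists_balancing {n : ℕ} (G : SimpleGraph (Fin n)) [DecidableRel G.Adj]
    (y : Fin n → Fin n → ℝ) (hy : ∀ i j, G.Adj i j → 0 < y i j)
    (e : Fin n → Fin n → ℝ) (he : ∀ i j, 0 ≤ e i j) :
    ∃ d : Fin n → ℝ, (∀ i, inj G y d e i = 0) ∧ (∀ i, 0 ≤ d i) ∧
      (∀ i, (∀ j, e i j = 0) → d i = 0) ∧ ∀ i j, G.Adj i j → 0 < e i j → 0 < d i := by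
  have hy' (i j : Fin n) (hj : j ∈ univ.filter (fun j => G.Adj i j)) : 0 < y i j :=
    hy i j (by simpa using hj)
  refine ⟨fun i => (∑ j ∈ univ.filter (fun j => G.Adj i j), e i j * y i j) /
    ∑ j ∈ univ.filter (fun j => G.Adj i j), y i j, fun i => ?_, fun i => ?_, fun i h => ?_,
    fun i j hij hj => ?_⟩
  · unfold inj
    simp only [sub_mul, sum_sub_distrib, ← mul_sum]
    rcases (univ.filter (fun j => G.Adj i j)).eq_empty_or_nonempty with h | h
    · simp [h]
    · rw [div_mul_cancel₀ _ (sum_pos (hy' i) h).ne', sub_self]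
  · exact div_nonneg (sum_nonneg fun j hj => mul_nonneg (he i j) (hy' i j hj).le)
      (sum_nonneg fun j hj => (hy' i j hj).le)
  · simp [h]
  · have hmem : j ∈ univ.filter (fun j => G.Adj i j) := by simp [hij]
    exact div_pos
      (sum_pos' (fun k hk => mul_nonneg (he i k) (hy' i k hk).le)
        ⟨j, hmem, mul_pos hj (hy' i j hmem)⟩)
      (sum_pos (hy' i) ⟨j, hmem⟩)

/-- Lemma 5 of the paper. Assume uniform positive voltage upper
bounds and `pLo i ≤ 0`. If `(p, v, W)` is feasible for RL1, the rank constraint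
fails on an edge `s ∼ t`, and both power-injection lower bounds at `s` and `t`
bind, then there exist `v', W'` such that `(p, v', W')` is feasible for RL1 (with
the same `p`) and the rank constraint fails on `s ∼ t` and on every edge sharing a
vertex with `{s, t}`. -/
theorem rank_violation_propagates {n : ℕ} (G : SimpleGraph (Fin n)) [DecidableRel G.Adj]
    (y : Fin n → Fin n → ℝ) (pLo pHi VLo VHi : Fin n → ℝ)
    (hVLo : ∀ i, 0 < VLo i) (hVbd : ∀ i, VLo i ≤ VHi i)
    (hVHiuni : ∀ i j, VHi i = VHi j) (hVHipos : ∀ i, 0 < VHi i)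
    (hpLo : ∀ i, pLo i ≤ 0) (hpHi : ∀ i, 0 ≤ pHi i)
    (hy : ∀ i j, G.Adj i j → 0 < y i j) (hysym : ∀ i j, y i j = y j i)
    (p v : Fin n → ℝ) (W : Fin n → Fin n → ℝ)
    (hfeas : FeasRL1 G y pLo pHi VLo VHi p v W)
    (s t : Fin n) (hst : G.Adj s t)
    (hviol : W s t * W t s < v s * v t)
    (hbs : p s = pLo s) (hbt : p t = pLo t) :
    ∃ v' W', FeasRL1 G y pLo pHi VLo VHi p v' W' ∧
      ∀ i j, G.Adj i j → (i = s ∨ i = t ∨ j = s ∨ j = t) →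
        W' i j * W' j i < v' i * v' j := by
  obtain ⟨hinj, hpb, hvb, hW0, hWsymm, hW⟩ := hfeas
  have hv (i : Fin n) : 0 < v i := (pow_pos (hVLo i) 2).trans_le (hvb i).1
  have hM (k i : Fin n) : v i ≤ VHi k ^ 2 := hVHiuni k i ▸ (hvb i).2
  have hs : v s < VHi s ^ 2 := lt_upper_of_slack G y hy v W _ (hM s) hv hWsymm hW s t hst hviol
    (by rw [← hinj s, hbs]; exact hpLo s)
  have ht : v t < VHi t ^ 2 := lt_upper_of_slack G y hy v W _ (hM t) hv hWsymm hW t s hst.symm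
    (by linarith [mul_comm (W s t) (W t s), mul_comm (v s) (v t)])
    (by rw [← hinj t, hbt]; exact hpLo t)
  let e : Fin n → Fin n → ℝ := fun i j => if i = s ∧ j = t ∨ i = t ∧ j = s then 1 else 0
  have he (i j : Fin n) : 0 ≤ e i j := by dsimp only [e]; split_ifs <;> norm_num
  have hesymm (i j : Fin n) : e i j = e j i := by
    dsimp only [e]
    congr 1
    exact propext (by tauto)
  obtain ⟨d, hd, hd0, hdz, hdpos⟩ := exists_balancing G y hy e he
  have hds : 0 < d s := hdpos s t hst (by simp [e])
  have hdt : 0 < d t := hdpos t s hst.symm (by simp [e])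
  have small {f g : ℝ → ℝ} (hf : Continuous f) (hg : Continuous g) (h : f 0 < g 0) :
      ∀ᶠ ε in nhdsWithin 0 (Set.Ioi 0), f ε < g ε :=
    (hf.continuousAt.eventually_lt hg.continuousAt h).filter_mono nhdsWithin_le_nhds
  obtain ⟨ε, hε, hεs, hεt, hεst⟩ := (eventually_mem_nhdsWithin.and
    ((small (f := fun ε => v s + ε * d s) (g := fun _ => VHi s ^ 2)
      (by fun_prop) (by fun_prop) (by simpa)).and
    ((small (f := fun ε => v t + ε * d t) (g := fun _ => VHi t ^ 2)
      (by fun_prop) (by fun_prop) (by simpa)).and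
    (small (f := fun ε => (W s t + ε * e s t) * (W t s + ε * e t s))
      (g := fun ε => (v s + ε * d s) * (v t + ε * d t))
      (by fun_prop) (by fun_prop) (by simpa))))).exists
  have hε : 0 < ε := hε
  have hvle (i : Fin n) : v i ≤ v i + ε * d i := le_add_of_nonneg_right (mul_nonneg hε.le (hd0 i))
  have hv' (i : Fin n) : 0 < v i + ε * d i := (hv i).trans_le (hvle i)
  have hmain (i j : Fin n) (hij : G.Adj i j) :
      (W i j + ε * e i j) * (W j i + ε * e j i) ≤ (v i + ε * d i) * (v j + ε * d j) ∧
      (i = s ∨ i = t ∨ j = s ∨ j = t →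
        (W i j + ε * e i j) * (W j i + ε * e j i) < (v i + ε * d i) * (v j + ε * d j)) := by
    by_cases h : i = s ∧ j = t ∨ i = t ∧ j = s
    · have hlt : (W i j + ε * e i j) * (W j i + ε * e j i) <
          (v i + ε * d i) * (v j + ε * d j) := by
        rcases h with ⟨rfl, rfl⟩ | ⟨rfl, rfl⟩
        · exact hεst
        · rw [mul_comm, mul_comm (v i + _)]
          exact hεst
      exact ⟨hlt.le, fun _ => hlt⟩
    · have hz : e i j = 0 := if_neg h
      rw [← hesymm i j, hz, mul_zero, add_zero, add_zero]
      refine ⟨(hW i j hij).trans (mul_le_mul (hvle i) (hvle j) (hv j).le (hv' i).le),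
        fun hor => (hW i j hij).trans_lt ?_⟩
      have hpos : 0 < d i ∨ 0 < d j := by
        rcases hor with rfl | rfl | rfl | rfl <;> tauto
      rcases hpos with hi | hj
      · exact mul_lt_mul (lt_add_of_pos_right _ (mul_pos hε hi)) (hvle j) (hv j) (hv' i).le
      · exact mul_lt_mul' (hvle i) (lt_add_of_pos_right _ (mul_pos hε hj)) (hv j).le (hv' i)
  refine ⟨fun i => v i + ε * d i, fun i j => W i j + ε * e i j,
    ⟨fun i => ?_, hpb, fun i => ⟨(hvb i).1.trans (hvle i), ?_⟩, fun i j hij => ?_,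
      fun i j hij => ?_, fun i j hij => (hmain i j hij).1⟩, fun i j hij => (hmain i j hij).2⟩
  · rw [inj_add_smul, hd, mul_zero, add_zero, hinj]
  · by_cases his : i = s
    · exact his ▸ hεs.le
    by_cases hit : i = t
    · exact hit ▸ hεt.le
    · simpa [hdz i (fun j => by simp [e, his, hit])] using (hvb i).2
  · exact add_nonneg (hW0 i j hij) (mul_nonneg hε.le (he i j))
  · change W i j + ε * e i j = W j i + ε * e j i
    rw [hWsymm i j hij, hesymm]
end

section
/- Assume G is connected, the voltage upper bounds are uniform, V̄_1=⋯=V̄_n>0, p̲_i≤0 for all i∈N, and each f_i is strictly increasing. Then RL1 is exact: every optimal solution (p*,v*,W*) of RL1 satisfying Σ_{i∈N} p*_i > 0 (positive total network loss) satisfies the rank constraint W*_{ij}W*_{ji} = v*_i v*_j on every edge i∼j, and hence is an optimal solution of OPF2. -/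
open Finset

/-- Feasibility for OPF2 = RL1 together with the rank constraint on every edge. -/
def FeasOPF2 {n : ℕ} (G : SimpleGraph (Fin n)) [DecidableRel G.Adj]
    (y : Fin n → Fin n → ℝ) (pLo pHi VLo VHi : Fin n → ℝ)
    (p v : Fin n → ℝ) (W : Fin n → Fin n → ℝ) : Prop :=
  FeasRL1 G y pLo pHi VLo VHi p v W ∧
  ∀ i j, G.Adj i j → W i j * W j i = v i * v j

/-- Optimality for RL1. -/
def OptRL1 {n : ℕ} (G : SimpleGraph (Fin n)) [DecidableRel G.Adj]
    (y : Fin n → Fin n → ℝ) (pLo pHi VLo VHi : Fin n → ℝ) (f : Fin n → ℝ → ℝ)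
    (p v : Fin n → ℝ) (W : Fin n → Fin n → ℝ) : Prop :=
  FeasRL1 G y pLo pHi VLo VHi p v W ∧
  ∀ q u X, FeasRL1 G y pLo pHi VLo VHi q u X → ∑ i, f i (p i) ≤ ∑ i, f i (q i)

/-- Optimality for OPF2. -/
def OptOPF2 {n : ℕ} (G : SimpleGraph (Fin n)) [DecidableRel G.Adj]
    (y : Fin n → Fin n → ℝ) (pLo pHi VLo VHi : Fin n → ℝ) (f : Fin n → ℝ → ℝ)
    (p v : Fin n → ℝ) (W : Fin n → Fin n → ℝ) : Prop :=
  FeasOPF2 G y pLo pHi VLo VHi p v W ∧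
  ∀ q u X, FeasOPF2 G y pLo pHi VLo VHi q u X → ∑ i, f i (p i) ≤ ∑ i, f i (q i)

/-- If `W i j * W j i < v i * v j` on some edge at `i` and `v i` is at the common upper bound,
then the injection at `i` is positive. -/
lemma inj_pos_of_slack_of_eq_upper {n : ℕ} (G : SimpleGraph (Fin n)) [DecidableRel G.Adj]
    {y : Fin n → Fin n → ℝ} (hy : ∀ i j, G.Adj i j → 0 < y i j)
    {v : Fin n → ℝ} {W : Fin n → Fin n → ℝ} {M : ℝ}
    (hv : ∀ i, 0 < v i ∧ v i ≤ M)
    (hWs : ∀ i j, G.Adj i j → W i j = W j i)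
    (hWle : ∀ i j, G.Adj i j → W i j * W j i ≤ v i * v j)
    {i b : Fin n} (hib : G.Adj i b) (hs : W i b * W b i < v i * v b) (hvi : v i = M) :
    0 < inj G y v W i := by
  have hM : 0 < M := hvi ▸ (hv i).1
  have hle (j : Fin n) (h : G.Adj i j) : v i * v j ≤ M * M :=
    mul_le_mul (hv i).2 (hv j).2 (hv j).1.le hM.le
  refine sum_pos' (fun j hj => ?_) ⟨b, by simpa using hib, ?_⟩
  · have hj : G.Adj i j := by simpa using hj
    have h1 := hWle i j hj
    rw [← hWs i j hj] at h1
    have h2 : W i j ≤ M := abs_le_of_sq_le_sq' (by nlinarith [hle j hj]) hM.le |>.2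
    exact mul_nonneg (by linarith) (hy i j hj).le
  · rw [← hWs i b hib] at hs
    have h2 : W i b < M := lt_of_pow_lt_pow_left₀ 2 hM.le (by nlinarith [hle b hib])
    exact mul_pos (by linarith) (hy i b hib)

/-- From a feasible point one can move to another one whose injections are nowhere larger, are
strictly smaller at the buses that meet a slack edge and have injection above the lower bound,
and such that every edge at the other buses that meet a slack edge becomes slack. -/
lemma exists_feasRL1_perturbation {n : ℕ} (G : SimpleGraph (Fin n)) [DecidableRel G.Adj]
    {y : Fin n → Fin n → ℝ} {pLo pHi VLo VHi : Fin n → ℝ}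
    (hVLo : ∀ i, 0 < VLo i) (hVHiuni : ∀ i j, VHi i = VHi j)
    (hpLo : ∀ i, pLo i ≤ 0) (hy : ∀ i j, G.Adj i j → 0 < y i j)
    {p v : Fin n → ℝ} {W : Fin n → Fin n → ℝ}
    (h : FeasRL1 G y pLo pHi VLo VHi p v W) :
    ∃ q u X, FeasRL1 G y pLo pHi VLo VHi q u X ∧ (∀ i, q i ≤ p i) ∧
      ∀ a b, G.Adj a b → W a b * W b a < v a * v b →
        (pLo a < p a → q a < p a) ∧
        (p a = pLo a → ∀ j, G.Adj a j → X a j * X j a < u a * u j) := by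
  classical
  obtain ⟨hp, hpb, hvb, hW0, hWs, hWle⟩ := h
  have hvpos (i) : 0 < v i := lt_of_lt_of_le (pow_pos (hVLo i) 2) (hvb i).1
  let E : Fin n → Fin n → ℝ := fun i j => if W i j * W j i < v i * v j then 1 else 0
  have hE0 (i j) : 0 ≤ E i j := by simp only [E]; split_ifs <;> norm_num
  have hE1 (i j) : E i j ≤ 1 := by simp only [E]; split_ifs <;> norm_num
  have hEs (i j) : E i j = E j i := by simp only [E, mul_comm]
  let Y : Fin n → ℝ := fun i => ∑ j ∈ univ.filter (fun j => G.Adj i j), y i j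
  let S : Fin n → ℝ := fun i => ∑ j ∈ univ.filter (fun j => G.Adj i j), E i j * y i j
  have hS0 (i) : 0 ≤ S i := sum_nonneg fun j hj =>
    mul_nonneg (hE0 i j) (hy i j (by simpa using hj)).le
  have hSY (i) : S i ≤ Y i := sum_le_sum fun j hj =>
    mul_le_of_le_one_left (hy i j (by simpa using hj)).le (hE1 i j)
  have hSpos (a b) (hab : G.Adj a b) (hs : W a b * W b a < v a * v b) : 0 < S a := by
    refine sum_pos' (fun j hj => mul_nonneg (hE0 a j) (hy a j (by simpa using hj)).le)
      ⟨b, by simpa using hab, ?_⟩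
    simpa [E, hs] using hy a b hab
  have hSslack (a) (ha : 0 < S a) : ∃ b, G.Adj a b ∧ W a b * W b a < v a * v b := by
    by_contra! hc
    refine ha.ne' (sum_eq_zero fun j hj => ?_)
    have := hc j (by simpa using hj)
    simp [E, not_lt.2 this]
  let d : Fin n → ℝ := fun i => if p i = pLo i then S i / Y i else 0
  have hd0 (i) : 0 ≤ d i := by
    simp only [d]; split_ifs
    · exact div_nonneg (hS0 i) ((hS0 i).trans (hSY i))
    · exact le_rfl
  have hdY (i) (hi : p i = pLo i) : d i * Y i = S i := by
    simp only [d, if_pos hi]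
    exact div_mul_cancel_of_imp fun h0 => le_antisymm (h0 ▸ hSY i) (hS0 i)
  have hdV (i) (hdi : d i ≠ 0) : v i < VHi i ^ 2 := by
    have hi : p i = pLo i := by by_contra hne; simp [d, hne] at hdi
    have hSi : 0 < S i := (hS0 i).lt_of_ne fun h0 => hdi (by simp [d, hi, ← h0])
    obtain ⟨b, hib, hs⟩ := hSslack i hSi
    refine (hvb i).2.lt_of_ne fun hvi => ?_
    have := inj_pos_of_slack_of_eq_upper G hy (M := VHi i ^ 2)
      (fun j => ⟨hvpos j, hVHiuni i j ▸ (hvb j).2⟩) hWs hWle hib hs hvi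
    linarith [hp i, hpLo i]
  have hinj (t : ℝ) (i) : inj G y (fun i => v i + t * d i) (fun i j => W i j + t * E i j) i
      = p i + t * (d i * Y i - S i) := by
    rw [hp i]
    simp only [inj, Y, S, mul_sum, ← sum_sub_distrib, ← sum_add_distrib]
    exact sum_congr rfl fun j _ => by ring
  have ev_lt {g : ℝ → ℝ} (hg : Continuous g) {c : ℝ} (h0 : g 0 < c) :
      ∀ᶠ t in nhdsWithin (0 : ℝ) (Set.Ioi 0), g t < c :=
    (hg.continuousAt.eventually_lt continuousAt_const h0).filter_mono nhdsWithin_le_nhds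
  have evP : ∀ᶠ t in nhdsWithin (0 : ℝ) (Set.Ioi 0), ∀ i, pLo i < p i → t * S i < p i - pLo i :=
    Filter.eventually_all.2 fun i => by
      by_cases hi : pLo i < p i
      · simpa [hi] using ev_lt (g := fun t => t * S i) (by fun_prop)
          (c := p i - pLo i) (by simpa using hi)
      · simp [hi]
  have evV : ∀ᶠ t in nhdsWithin (0 : ℝ) (Set.Ioi 0), ∀ i, d i ≠ 0 → v i + t * d i < VHi i ^ 2 :=
    Filter.eventually_all.2 fun i => by
      by_cases hi : d i = 0
      · simp [hi]
      · simpa [hi] using ev_lt (g := fun t => v i + t * d i) (by fun_prop)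
          (c := VHi i ^ 2) (by simpa using hdV i hi)
  have evW : ∀ᶠ t in nhdsWithin (0 : ℝ) (Set.Ioi 0), ∀ i j, W i j * W j i < v i * v j →
      (W i j + t * E i j) * (W j i + t * E j i) < v i * v j :=
    Filter.eventually_all.2 fun i => Filter.eventually_all.2 fun j => by
      by_cases hs : W i j * W j i < v i * v j
      · simpa only [hs, true_imp_iff] using
          ev_lt (g := fun t => (W i j + t * E i j) * (W j i + t * E j i)) (by fun_prop)
            (c := v i * v j) (by simpa using hs)
      · simp [hs]
  obtain ⟨t, htP, htV, htW, ht⟩ :=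
    (evP.and (evV.and (evW.and eventually_mem_nhdsWithin))).exists
  have ht : 0 < t := ht
  have hvu (i) : v i ≤ v i + t * d i := le_add_of_nonneg_right (mul_nonneg ht.le (hd0 i))
  have hvv (i j) : v i * v j ≤ (v i + t * d i) * (v j + t * d j) :=
    mul_le_mul (hvu i) (hvu j) (hvpos j).le ((hvpos i).le.trans (hvu i))
  have htight (i) (hi : p i = pLo i) : p i + t * (d i * Y i - S i) = p i := by
    rw [hdY i hi]; ring
  have hloose (i) (hi : pLo i < p i) : p i + t * (d i * Y i - S i) = p i - t * S i := by
    simp only [d, if_neg hi.ne']; ring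
  have hqle (i) : p i + t * (d i * Y i - S i) ≤ p i := by
    rcases (hpb i).1.eq_or_lt with hi | hi
    · exact (htight i hi.symm).le
    · rw [hloose i hi]; linarith [mul_nonneg ht.le (hS0 i)]
  refine ⟨fun i => p i + t * (d i * Y i - S i), fun i => v i + t * d i,
    fun i j => W i j + t * E i j,
    ⟨fun i => (hinj t i).symm, fun i => ⟨?_, (hqle i).trans (hpb i).2⟩,
      fun i => ⟨(hvb i).1.trans (hvu i), ?_⟩,
      fun i j hij => add_nonneg (hW0 i j hij) (mul_nonneg ht.le (hE0 i j)),
      fun i j hij => by simp only [hWs i j hij, hEs i j], fun i j hij => ?_⟩, hqle,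
    fun a b hab hs => ⟨fun ha => ?_, fun ha j haj => ?_⟩⟩
  · rcases (hpb i).1.eq_or_lt with hi | hi
    · exact hi.le.trans (htight i hi.symm).ge
    · have := hloose i hi
      linarith [htP i hi]
  · by_cases hi : d i = 0
    · simpa [hi] using (hvb i).2
    · exact (htV i hi).le
  · by_cases hs : W i j * W j i < v i * v j
    · exact (htW i j hs).le.trans (hvv i j)
    · have h1 : E i j = 0 := if_neg hs
      simpa [h1, ← hEs i j] using (hWle i j hij).trans (hvv i j)
  · have := hloose a ha
    linarith [mul_pos ht (hSpos a b hab hs)]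
  · by_cases hs' : W a j * W j a < v a * v j
    · exact (htW a j hs').trans_le (hvv a j)
    · have h1 : E a j = 0 := if_neg hs'
      have hda : 0 < d a := by
        simp only [d, if_pos ha]
        exact div_pos (hSpos a b hab hs) ((hSpos a b hab hs).trans_le (hSY a))
      have h2 : v a < v a + t * d a := lt_add_of_pos_right _ (mul_pos ht hda)
      have h3 : v a * v j < (v a + t * d a) * (v j + t * d j) :=
        mul_lt_mul h2 (hvu j) (hvpos j) ((hvpos a).le.trans (hvu a))
      simpa [h1, ← hEs a j] using (hWle a j haj).trans_lt h3

/-- For injections `p` that are minimal among the feasible ones, no slack edge of a feasible point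
can be joined by a walk to a bus whose injection is above its lower bound. -/
lemma not_slack_of_walk {n : ℕ} (G : SimpleGraph (Fin n)) [DecidableRel G.Adj]
    {y : Fin n → Fin n → ℝ} {pLo pHi VLo VHi : Fin n → ℝ}
    (hVLo : ∀ i, 0 < VLo i) (hVHiuni : ∀ i j, VHi i = VHi j)
    (hpLo : ∀ i, pLo i ≤ 0) (hy : ∀ i j, G.Adj i j → 0 < y i j) {p : Fin n → ℝ}
    (hmin : ∀ q u X, FeasRL1 G y pLo pHi VLo VHi q u X → (∀ i, q i ≤ p i) → q = p)
    {a s : Fin n} (w : G.Walk a s) (hps : pLo s < p s)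
    {v : Fin n → ℝ} {W : Fin n → Fin n → ℝ} (h : FeasRL1 G y pLo pHi VLo VHi p v W)
    {b : Fin n} (hab : G.Adj a b) : ¬ W a b * W b a < v a * v b := by
  induction w generalizing v W b with
  | nil =>
    intro hs
    obtain ⟨q, u, X, hq, hqp, hX⟩ :=
      exists_feasRL1_perturbation G hVLo hVHiuni hpLo hy h
    exact ((hX _ b hab hs).1 hps).ne (congrFun (hmin q u X hq hqp) _)
  | @cons a c s hac w ih =>
    intro hs
    obtain ⟨q, u, X, hq, hqp, hX⟩ :=
      exists_feasRL1_perturbation G hVLo hVHiuni hpLo hy h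
    obtain rfl := hmin q u X hq hqp
    have ha : q a = pLo a :=
      le_antisymm (not_lt.1 fun hlt => ((hX a b hab hs).1 hlt).false) (hq.2.1 a).1
    refine ih hps hq hac.symm ?_
    simpa only [mul_comm] using (hX a b hab hs).2 ha c hac

/-- Theorem 2 of the paper: exactness of RL1. Assume `G` is
connected, the voltage upper bounds are uniform and positive, `pLo i ≤ 0`, and the
cost functions are strictly increasing. Then every optimal solution of RL1 with
positive total injection (network loss) satisfies the rank constraint on every
edge, and hence is an optimal solution of OPF2. -/
theorem rl1_exact {n : ℕ} (G : SimpleGraph (Fin n)) [DecidableRel G.Adj]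
    (hconn : G.Connected)
    (y : Fin n → Fin n → ℝ) (pLo pHi VLo VHi : Fin n → ℝ) (f : Fin n → ℝ → ℝ)
    (hVLo : ∀ i, 0 < VLo i) (hVbd : ∀ i, VLo i ≤ VHi i)
    (hVHiuni : ∀ i j, VHi i = VHi j) (hVHipos : ∀ i, 0 < VHi i)
    (hpLo : ∀ i, pLo i ≤ 0) (hpHi : ∀ i, 0 ≤ pHi i)
    (hy : ∀ i j, G.Adj i j → 0 < y i j) (hysym : ∀ i j, y i j = y j i)
    (hf : ∀ i, StrictMono (f i))
    (p v : Fin n → ℝ) (W : Fin n → Fin n → ℝ)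
    (hopt : OptRL1 G y pLo pHi VLo VHi f p v W)
    (hloss : 0 < ∑ i, p i) :
    (∀ i j, G.Adj i j → W i j * W j i = v i * v j) ∧
    OptOPF2 G y pLo pHi VLo VHi f p v W := by
  obtain ⟨hfeas, hbest⟩ := hopt
  have hmin (q u X) (hq : FeasRL1 G y pLo pHi VLo VHi q u X) (hqp : ∀ i, q i ≤ p i) : q = p := by
    by_contra hne
    obtain ⟨i, hi⟩ := Function.ne_iff.1 hne
    exact (hbest q u X hq).not_gt (sum_lt_sum (fun j _ => (hf j).monotone (hqp j))
      ⟨i, mem_univ i, hf i ((hqp i).lt_of_ne hi)⟩)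
  obtain ⟨s, -, hs⟩ := exists_lt_of_sum_lt (s := univ) (f := fun _ : Fin n => (0 : ℝ))
    (by simpa using hloss)
  have hrank (i j) (hij : G.Adj i j) : W i j * W j i = v i * v j := by
    obtain ⟨w⟩ := hconn.preconnected i s
    exact (hfeas.2.2.2.2.2 i j hij).eq_of_not_lt
      (not_slack_of_walk G hVLo hVHiuni hpLo hy hmin w ((hpLo s).trans_lt hs) hfeas hij)
  exact ⟨hrank, ⟨hfeas, hrank⟩, fun q u X hq => hbest q u X hq.1⟩
end

section
/- Assume the voltage upper bounds are uniform, V̄_1=⋯=V̄_n>0, p̲_i≤0 for all i∈N, and each f_i is strictly increasing. Let (p,v,W) be feasible for RL2 and suppose: the rank constraint holds (W_{ij}W_{ji}=v_i v_j) on every edge except one edge s∼t, where it fails (W_{st}W_{ts} < v_s v_t); the line constraint is binding on s∼t, i.e., y_{st}²(v_s−W_{st}−W_{ts}+v_t)=Ī_{st}²; and at least one of p_s=p̲_s, p_t=p̲_t holds. Set ε:=√(v_s v_t)−W_{st}>0, define W'_{st}=W'_{ts}=W_{st}+ε and W'_{ij}=W_{ij} otherwise, and p'_i:=Σ_{j∼i}(v_i−W'_{ij})y_{ij}.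 Then (p',v,W'): (1) satisfies all constraints of RL2 except possibly the power-injection bounds p̲_i≤p'_i≤p̄_i; (2) satisfies the rank constraint on every edge; and (3) has h(p') < h(p). Moreover p'_i = p_i for i∉{s,t} and p'_i = p_i − y_{st}ε < p_i for i∈{s,t}. -/
open Finset

/-- Feasibility for RL2 = RL1 together with the line (current) constraints. -/
def FeasRL2 {n : ℕ} (G : SimpleGraph (Fin n)) [DecidableRel G.Adj]
    (y : Fin n → Fin n → ℝ) (pLo pHi VLo VHi : Fin n → ℝ)
    (Ibar : Fin n → Fin n → ℝ)
    (p v : Fin n → ℝ) (W : Fin n → Fin n → ℝ) : Prop :=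
  FeasRL1 G y pLo pHi VLo VHi p v W ∧
  ∀ i j, G.Adj i j → y i j ^ 2 * (v i - W i j - W j i + v j) ≤ Ibar i j ^ 2

/-- The modified `W` obtained by adding `ε = √(vₛvₜ) − W_{st}` on the (ordered
pairs of the) edge `s ∼ t`. -/
noncomputable def Wfix {n : ℕ} (s t : Fin n) (v : Fin n → ℝ)
    (W : Fin n → Fin n → ℝ) : Fin n → Fin n → ℝ :=
  fun i j =>
    if (i = s ∧ j = t) ∨ (i = t ∧ j = s) then
      W i j + (Real.sqrt (v s * v t) - W s t)
    else W i j

/-- All constraints of RL2 except the power-injection bounds. -/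
def FeasRL2NoPBounds {n : ℕ} (G : SimpleGraph (Fin n)) [DecidableRel G.Adj]
    (y : Fin n → Fin n → ℝ) (VLo VHi : Fin n → ℝ) (Ibar : Fin n → Fin n → ℝ)
    (p v : Fin n → ℝ) (W : Fin n → Fin n → ℝ) : Prop :=
  (∀ i, p i = inj G y v W i) ∧
  (∀ i, VLo i ^ 2 ≤ v i ∧ v i ≤ VHi i ^ 2) ∧
  (∀ i j, G.Adj i j → 0 ≤ W i j) ∧
  (∀ i j, G.Adj i j → W i j = W j i) ∧
  (∀ i j, G.Adj i j → W i j * W j i ≤ v i * v j) ∧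
  (∀ i j, G.Adj i j → y i j ^ 2 * (v i - W i j - W j i + v j) ≤ Ibar i j ^ 2)

/-- Raising the single entry `W i k` by `ε` lowers the injection at `i` by `y i k * ε`. -/
theorem inj_eq_sub_of_raise {n : ℕ} (G : SimpleGraph (Fin n)) [DecidableRel G.Adj]
    (y : Fin n → Fin n → ℝ) (v : Fin n → ℝ) {W W' : Fin n → Fin n → ℝ} {i k : Fin n} {ε : ℝ}
    (hik : G.Adj i k) (hk : W' i k = W i k + ε) (hne : ∀ j, j ≠ k → W' i j = W i j) :
    inj G y v W' i = inj G y v W i - y i k * ε := by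
  have hmem : k ∈ univ.filter (fun j => G.Adj i j) := by simpa using hik
  unfold inj
  rw [← Finset.add_sum_erase _ _ hmem, ← Finset.add_sum_erase _ _ hmem,
    Finset.sum_congr rfl fun j hj => by rw [hne j (Finset.ne_of_mem_erase hj)], hk]
  ring

theorem inj_congr {n : ℕ} (G : SimpleGraph (Fin n)) [DecidableRel G.Adj]
    (y : Fin n → Fin n → ℝ) (v : Fin n → ℝ) {W W' : Fin n → Fin n → ℝ} {i : Fin n}
    (h : ∀ j, W' i j = W i j) : inj G y v W' i = inj G y v W i := by
  simp only [inj, h]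

theorem Wfix_of_not {n : ℕ} {s t : Fin n} (v : Fin n → ℝ) (W : Fin n → Fin n → ℝ) {i j : Fin n}
    (h : ¬((i = s ∧ j = t) ∨ (i = t ∧ j = s))) : Wfix s t v W i j = W i j :=
  if_neg h

theorem Wfix_left {n : ℕ} (s t : Fin n) (v : Fin n → ℝ) (W : Fin n → Fin n → ℝ) :
    Wfix s t v W s t = Real.sqrt (v s * v t) := by
  simp [Wfix]

theorem Wfix_right {n : ℕ} {s t : Fin n} (v : Fin n → ℝ) {W : Fin n → Fin n → ℝ}
    (h : W s t = W t s) : Wfix s t v W t s = Real.sqrt (v s * v t) := by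
  simp [Wfix, h]

/-- Theorem 7 of the paper. Assume uniform positive voltage
upper bounds, `pLo i ≤ 0`, and strictly increasing costs. Let `(p, v, W)` be
feasible for RL2, with the rank constraint holding on every edge except `s ∼ t`,
where it fails; suppose the line constraint binds on `s ∼ t` and at least one of
the power-injection lower bounds at `s`, `t` binds. Set `ε = √(vₛvₜ) − W_{st} > 0`,
`W' = Wfix s t v W`, `p'_i = ∑_{j∼i}(v_i − W'_{ij})y_{ij}`. Then `(p', v, W')`
satisfies all constraints of RL2 except the power bounds, satisfies the rank
constraint on every edge, and has a strictly smaller objective; moreover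
`p'_i = p_i` off `{s, t}` and `p'_i = p_i − y_{st}ε < p_i` for `i ∈ {s, t}`. -/
theorem rl2_binding_recovery {n : ℕ} (G : SimpleGraph (Fin n)) [DecidableRel G.Adj]
    (y : Fin n → Fin n → ℝ) (pLo pHi VLo VHi : Fin n → ℝ)
    (Ibar : Fin n → Fin n → ℝ) (f : Fin n → ℝ → ℝ)
    (hVLo : ∀ i, 0 < VLo i) (hVbd : ∀ i, VLo i ≤ VHi i)
    (hVHiuni : ∀ i j, VHi i = VHi j) (hVHipos : ∀ i, 0 < VHi i)
    (hpLo : ∀ i, pLo i ≤ 0) (hpHi : ∀ i, 0 ≤ pHi i)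
    (hy : ∀ i j, G.Adj i j → 0 < y i j) (hysym : ∀ i j, y i j = y j i)
    (hI : ∀ i j, G.Adj i j → 0 < Ibar i j) (hIsym : ∀ i j, Ibar i j = Ibar j i)
    (hf : ∀ i, StrictMono (f i))
    (p v : Fin n → ℝ) (W : Fin n → Fin n → ℝ)
    (hfeas : FeasRL2 G y pLo pHi VLo VHi Ibar p v W)
    (s t : Fin n) (hst : G.Adj s t)
    (hrank_other : ∀ i j, G.Adj i j →
      ¬((i = s ∧ j = t) ∨ (i = t ∧ j = s)) → W i j * W j i = v i * v j)
    (hviol : W s t * W t s < v s * v t)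
    (hbindline : y s t ^ 2 * (v s - W s t - W t s + v t) = Ibar s t ^ 2)
    (hbindp : p s = pLo s ∨ p t = pLo t) :
    0 < Real.sqrt (v s * v t) - W s t ∧
    FeasRL2NoPBounds G y VLo VHi Ibar
      (fun i => inj G y v (Wfix s t v W) i) v (Wfix s t v W) ∧
    (∀ i j, G.Adj i j →
      Wfix s t v W i j * Wfix s t v W j i = v i * v j) ∧
    (∑ i, f i (inj G y v (Wfix s t v W) i)) < ∑ i, f i (p i) ∧
    (∀ i, i ≠ s → i ≠ t → inj G y v (Wfix s t v W) i = p i) ∧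
    (inj G y v (Wfix s t v W) s
        = p s - y s t * (Real.sqrt (v s * v t) - W s t) ∧
      inj G y v (Wfix s t v W) s < p s) ∧
    (inj G y v (Wfix s t v W) t
        = p t - y s t * (Real.sqrt (v s * v t) - W s t) ∧
      inj G y v (Wfix s t v W) t < p t) := by
  obtain ⟨⟨hp, -, hv, hW0, hWsymm, -⟩, hline⟩ := hfeas
  have hWst := hWsymm s t hst
  have hvpos : ∀ i, 0 < v i := fun i => (pow_pos (hVLo i) 2).trans_le (hv i).1
  have hprod : 0 ≤ v s * v t := (mul_pos (hvpos s) (hvpos t)).le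
  have hε : 0 < Real.sqrt (v s * v t) - W s t :=
    sub_pos.2 (Real.lt_sqrt_of_sq_lt (by rw [sq]; nth_rewrite 2 [hWst]; exact hviol))
  have hle : ∀ i j, W i j ≤ Wfix s t v W i j := by
    intro i j
    unfold Wfix
    split_ifs <;> linarith
  have hrank : ∀ i j, G.Adj i j → Wfix s t v W i j * Wfix s t v W j i = v i * v j := by
    intro i j hij
    by_cases h : (i = s ∧ j = t) ∨ (i = t ∧ j = s)
    · rcases h with ⟨rfl, rfl⟩ | ⟨rfl, rfl⟩
      · rw [Wfix_left, Wfix_right v hWst, Real.mul_self_sqrt hprod]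
      · rw [Wfix_left, Wfix_right v hWst, Real.mul_self_sqrt hprod, mul_comm]
    · rw [Wfix_of_not v W h, Wfix_of_not v W (by tauto), hrank_other i j hij h]
  have hsymm : ∀ i j, G.Adj i j → Wfix s t v W i j = Wfix s t v W j i := by
    intro i j hij
    by_cases h : (i = s ∧ j = t) ∨ (i = t ∧ j = s)
    · rcases h with ⟨rfl, rfl⟩ | ⟨rfl, rfl⟩ <;> rw [Wfix_left, Wfix_right v hWst]
    · rw [Wfix_of_not v W h, Wfix_of_not v W (by tauto), hWsymm i j hij]
  have hne := hst.ne
  have hinj_s : inj G y v (Wfix s t v W) s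
      = p s - y s t * (Real.sqrt (v s * v t) - W s t) := by
    rw [hp s]
    refine inj_eq_sub_of_raise G y v hst (by rw [Wfix_left]; ring) fun j hj => ?_
    exact Wfix_of_not v W (by tauto)
  have hinj_t : inj G y v (Wfix s t v W) t
      = p t - y s t * (Real.sqrt (v s * v t) - W s t) := by
    rw [hp t, hysym s t]
    refine inj_eq_sub_of_raise G y v hst.symm
      (by rw [Wfix_right v hWst, hWst]; ring) fun j hj => ?_
    exact Wfix_of_not v W (by have := hne.symm; tauto)
  have hinj_other : ∀ i, i ≠ s → i ≠ t → inj G y v (Wfix s t v W) i = p i := by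
    intro i his hit
    rw [hp i]
    exact inj_congr G y v fun j => Wfix_of_not v W (by tauto)
  have hdrop := mul_pos (hy s t hst) hε
  have hlt_s : inj G y v (Wfix s t v W) s < p s := by linarith
  have hlt_t : inj G y v (Wfix s t v W) t < p t := by linarith
  have hinj_le : ∀ i, inj G y v (Wfix s t v W) i ≤ p i := by
    intro i
    by_cases his : i = s
    · exact his ▸ hlt_s.le
    by_cases hit : i = t
    · exact hit ▸ hlt_t.le
    exact (hinj_other i his hit).le
  refine ⟨hε, ⟨fun _ => rfl, hv, fun i j hij => (hW0 i j hij).trans (hle i j), hsymm,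
    fun i j hij => (hrank i j hij).le, fun i j hij => ?_⟩, hrank, ?_, hinj_other,
    ⟨hinj_s, hlt_s⟩, ⟨hinj_t, hlt_t⟩⟩
  · refine le_trans (mul_le_mul_of_nonneg_left ?_ (sq_nonneg _)) (hline i j hij)
    linarith [hle i j, hle j i]
  · exact Finset.sum_lt_sum (fun i _ => (hf i).monotone (hinj_le i))
      ⟨s, Finset.mem_univ s, hf s hlt_s⟩
end

section
/- Let (p*,v*,W*) be feasible for RL2, and define V_i:=√(v*_i) for every bus i∈N. Then V satisfies the voltage bounds V̲_i≤V_i≤V̄_i and, for every edge i∼j, the line constraint y_{ij}²(V_i−V_j)² ≤ Ī_{ij}²; moreover this inequality is strict on every edge i∼j where the rank constraint fails, i.e., where W*_{ij} < √(v*_i v*_j). -/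
open Finset

/-- direct construction, step 1. Let `(p, v, W)` be feasible for
RL2 and set `V i = √(v i)`. Then `V` satisfies the voltage bounds and, on every
edge, the line constraint `y_{ij}²(V_i − V_j)² ≤ Ī_{ij}²`; the inequality is strict
on every edge where the rank constraint fails, i.e. where `W i j < √(v i * v j)`. -/
theorem direct_construction_line_feasible {n : ℕ} (G : SimpleGraph (Fin n))
    [DecidableRel G.Adj]
    (y : Fin n → Fin n → ℝ) (pLo pHi VLo VHi : Fin n → ℝ)
    (Ibar : Fin n → Fin n → ℝ)
    (hVLo : ∀ i, 0 < VLo i) (hVbd : ∀ i, VLo i ≤ VHi i)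
    (hpLo : ∀ i, pLo i ≤ 0) (hpHi : ∀ i, 0 ≤ pHi i)
    (hy : ∀ i j, G.Adj i j → 0 < y i j) (hysym : ∀ i j, y i j = y j i)
    (hI : ∀ i j, G.Adj i j → 0 < Ibar i j) (hIsym : ∀ i j, Ibar i j = Ibar j i)
    (p v : Fin n → ℝ) (W : Fin n → Fin n → ℝ)
    (hfeas : FeasRL2 G y pLo pHi VLo VHi Ibar p v W) :
    (∀ i, VLo i ≤ Real.sqrt (v i) ∧ Real.sqrt (v i) ≤ VHi i) ∧
    (∀ i j, G.Adj i j →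
      y i j ^ 2 * (Real.sqrt (v i) - Real.sqrt (v j)) ^ 2 ≤ Ibar i j ^ 2) ∧
    (∀ i j, G.Adj i j → W i j < Real.sqrt (v i * v j) →
      y i j ^ 2 * (Real.sqrt (v i) - Real.sqrt (v j)) ^ 2 < Ibar i j ^ 2) := by
  obtain ⟨⟨-, -, hv, -, hWsym, hWle⟩, hline⟩ := hfeas
  have hv0 (i) : 0 ≤ v i := (sq_nonneg _).trans (hv i).1
  have sqrt_sub_sq (i j) : (√(v i) - √(v j)) ^ 2 = v i - 2 * √(v i * v j) + v j := by
    rw [sub_sq, Real.sq_sqrt (hv0 i), Real.sq_sqrt (hv0 j), Real.sqrt_mul (hv0 i)]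
    ring
  have W_le (i j) (h : G.Adj i j) : W i j ≤ √(v i * v j) := by
    apply Real.le_sqrt_of_sq_le
    simpa [sq, ← hWsym i j h] using hWle i j h
  refine ⟨fun i => ⟨Real.le_sqrt_of_sq_le (hv i).1,
    (Real.sqrt_le_left ((hVLo i).le.trans (hVbd i))).2 (hv i).2⟩,
    fun i j h => ?_, fun i j h hlt => ?_⟩
  · refine le_trans ?_ (hline i j h)
    rw [sqrt_sub_sq, ← hWsym i j h]
    exact mul_le_mul_of_nonneg_left (by linarith [W_le i j h]) (sq_nonneg _)
  · refine lt_of_lt_of_le ?_ (hline i j h)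
    rw [sqrt_sub_sq, ← hWsym i j h]
    exact mul_lt_mul_of_pos_left (by linarith) (pow_pos (hy i j h) 2)
end

section
/- Let (p*,v*,W*) be feasible for RL2, define V_i:=√(v*_i) for every bus i∈N and p_i:=Σ_{j∼i}V_i(V_i−V_j)y_{ij}, and for each bus i let B_i:={j : j∼i and W*_{ij} < √(v*_i v*_j)} be the set of neighbors of i across edges violating the rank constraint. Then for every bus i, p_i = p*_i + Σ_{j∈B_i}(W*_{ij} − √(v*_i v*_j))y_{ij} ≤ p*_i; in particular p_i = p*_i whenever the rank constraint holds on every edge incident to i, and the deficit satisfies p*_i − p_i ≤ Σ_{j∈B_i}(√(v*_i v*_j) − W*_{ij})y_{ij}. -/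
open Finset

/-- The power injection at bus `i` induced by the voltages `V i = √(v i)`. -/
noncomputable def injV {n : ℕ} (G : SimpleGraph (Fin n)) [DecidableRel G.Adj]
    (y : Fin n → Fin n → ℝ) (v : Fin n → ℝ) (i : Fin n) : ℝ :=
  ∑ j ∈ univ.filter (fun j => G.Adj i j),
    Real.sqrt (v i) * (Real.sqrt (v i) - Real.sqrt (v j)) * y i j

open Classical in
/-- `Bset G v W i` is the set of neighbours `j` of `i` whose edge `i ∼ j` violates
the rank constraint, i.e. `W i j < √(v i * v j)`. -/
noncomputable def Bset {n : ℕ} (G : SimpleGraph (Fin n)) [DecidableRel G.Adj]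
    (v : Fin n → ℝ) (W : Fin n → Fin n → ℝ) (i : Fin n) : Finset (Fin n) :=
  univ.filter (fun j => G.Adj i j ∧ W i j < Real.sqrt (v i * v j))

/-- At an RL1-feasible point, the entry `W i j` of an edge is at
most the geometric mean of `v i` and `v j`. -/
theorem FeasRL1.le_sqrt {n : ℕ} {G : SimpleGraph (Fin n)} [DecidableRel G.Adj]
    {y : Fin n → Fin n → ℝ} {pLo pHi VLo VHi p v : Fin n → ℝ} {W : Fin n → Fin n → ℝ}
    (h : FeasRL1 G y pLo pHi VLo VHi p v W) {i j : Fin n} (hij : G.Adj i j) :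
    W i j ≤ √(v i * v j) := by
  obtain ⟨-, -, -, -, hsymm, hrank⟩ := h
  refine Real.le_sqrt_of_sq_le ?_
  have := hrank i j hij
  rwa [← hsymm i j hij, ← sq] at this

/-- The rank constraint forces `W i j` to be the geometric mean of `v i` and `v j`. -/
theorem FeasRL1.eq_sqrt {n : ℕ} {G : SimpleGraph (Fin n)} [DecidableRel G.Adj]
    {y : Fin n → Fin n → ℝ} {pLo pHi VLo VHi p v : Fin n → ℝ} {W : Fin n → Fin n → ℝ}
    (h : FeasRL1 G y pLo pHi VLo VHi p v W) {i j : Fin n} (hij : G.Adj i j)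
    (hrank : W i j * W j i = v i * v j) : W i j = √(v i * v j) := by
  obtain ⟨-, -, -, hW, hsymm, -⟩ := h
  rw [← hrank, ← hsymm i j hij, Real.sqrt_mul_self (hW i j hij)]

/-- The voltage-induced injection is the relaxed one corrected along the violating edges. -/
theorem FeasRL1.injV_eq {n : ℕ} {G : SimpleGraph (Fin n)} [DecidableRel G.Adj]
    {y : Fin n → Fin n → ℝ} {pLo pHi VLo VHi p v : Fin n → ℝ} {W : Fin n → Fin n → ℝ}
    (h : FeasRL1 G y pLo pHi VLo VHi p v W) (i : Fin n) :
    injV G y v i = p i + ∑ j ∈ Bset G v W i, (W i j - √(v i * v j)) * y i j := by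
  have hB : ∑ j ∈ Bset G v W i, (W i j - √(v i * v j)) * y i j
      = ∑ j ∈ univ.filter (fun j => G.Adj i j), (W i j - √(v i * v j)) * y i j := by
    refine sum_subset (fun j hj => ?_) (fun j hj hjB => ?_)
    · simp only [Bset, mem_filter, mem_univ, true_and] at hj ⊢
      exact hj.1
    · simp only [Bset, mem_filter, mem_univ, true_and, not_and, not_lt] at hj hjB
      rw [le_antisymm (h.le_sqrt hj) (hjB hj), sub_self, zero_mul]
  have hv : 0 ≤ v i := (sq_nonneg _).trans (h.2.2.1 i).1
  rw [hB, h.1 i, inj, injV, ← sum_add_distrib]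
  refine sum_congr rfl fun j _ => ?_
  rw [Real.sqrt_mul hv, mul_sub, Real.mul_self_sqrt hv]
  ring

/-- direct construction, step 2. Let `(p, v, W)` be feasible for
RL2, set `V i = √(v i)` and let `p̂ i = injV G y v i` be the induced injections.
Then for every bus `i`,
`p̂ i = p i + ∑_{j ∈ B i} (W i j − √(v i v j)) y i j ≤ p i`; in particular
`p̂ i = p i` whenever the rank constraint holds on every edge incident to `i`, and
the deficit satisfies `p i − p̂ i ≤ ∑_{j ∈ B i} (√(v i v j) − W i j) y i j`. -/
theorem direct_construction_injections {n : ℕ} (G : SimpleGraph (Fin n))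
    [DecidableRel G.Adj]
    (y : Fin n → Fin n → ℝ) (pLo pHi VLo VHi : Fin n → ℝ)
    (Ibar : Fin n → Fin n → ℝ)
    (hVLo : ∀ i, 0 < VLo i) (hVbd : ∀ i, VLo i ≤ VHi i)
    (hpLo : ∀ i, pLo i ≤ 0) (hpHi : ∀ i, 0 ≤ pHi i)
    (hy : ∀ i j, G.Adj i j → 0 < y i j) (hysym : ∀ i j, y i j = y j i)
    (hI : ∀ i j, G.Adj i j → 0 < Ibar i j) (hIsym : ∀ i j, Ibar i j = Ibar j i)
    (p v : Fin n → ℝ) (W : Fin n → Fin n → ℝ)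
    (hfeas : FeasRL2 G y pLo pHi VLo VHi Ibar p v W) :
    (∀ i, injV G y v i
      = p i + ∑ j ∈ Bset G v W i, (W i j - Real.sqrt (v i * v j)) * y i j) ∧
    (∀ i, injV G y v i ≤ p i) ∧
    (∀ i, (∀ j, G.Adj i j → W i j * W j i = v i * v j) → injV G y v i = p i) ∧
    (∀ i, p i - injV G y v i
      ≤ ∑ j ∈ Bset G v W i, (Real.sqrt (v i * v j) - W i j) * y i j) := by
  have h := hfeas.1
  refine ⟨h.injV_eq, fun i => ?_, fun i hrank => ?_, fun i => ?_⟩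
  · rw [h.injV_eq i]
    refine add_le_of_nonpos_right (sum_nonpos fun j hj => ?_)
    simp only [Bset, mem_filter, mem_univ, true_and] at hj
    exact mul_nonpos_of_nonpos_of_nonneg (sub_nonpos.2 hj.2.le) (hy i j hj.1).le
  · rw [h.injV_eq i, add_eq_left]
    refine sum_eq_zero fun j hj => ?_
    simp only [Bset, mem_filter, mem_univ, true_and] at hj
    rw [h.eq_sqrt hj.1 (hrank j hj.1), sub_self, zero_mul]
  · rw [h.injV_eq i, sub_add_cancel_left, ← sum_neg_distrib]
    exact (sum_congr rfl fun j _ => by ring).le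
end
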